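/- arXiv:2012.11561 — 3 statements merged into one kernel-verified Lean document; each statement's English description precedes it below -/
import Mathlib

section
/- For every t > 0, (4 + t²)·K₀(t) − 2t·K₁(t) > 0. -/
/-- Modified Bessel function of the second kind, order 0. -/
noncomputable def K0 (x : ℝ) : ℝ := ∫ t in Set.Ioi (0:ℝ), Real.exp (-x * Real.cosh t)

/-- Modified Bessel function of the second kind, order 1. -/
noncomputable def K1 (x : ℝ) : ℝ := ∫ t in Set.Ioi (0:ℝ), Real.exp (-x * Real.cosh t) * Real.cosh t

open Real Set Filter Topology MeasureTheory

lemma exp_neg_mul_cosh_mul_cosh_le {x : ℝ} (hx : 0 < x) (u : ℝ) :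
    exp (-x * cosh u) * cosh u ≤ 4 / x ^ 2 * exp (-u) := by
  have hc : 0 < cosh u := cosh_pos u
  have hq := quadratic_le_exp_of_nonneg (mul_pos hx hc).le
  have hcosh : exp u ≤ 2 * cosh u := by
    rw [cosh_eq]; linarith [exp_pos (-u)]
  have h1 : x ^ 2 * cosh u ^ 2 ≤ 2 * exp (x * cosh u) := by
    nlinarith [mul_pos hx hc]
  rw [neg_mul, exp_neg, exp_neg, inv_mul_eq_div, ← div_eq_mul_inv, div_div,
    div_le_div_iff₀ (exp_pos _) (by positivity)]
  calc cosh u * (x ^ 2 * exp u) ≤ cosh u * (x ^ 2 * (2 * cosh u)) := by gcongr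
    _ ≤ 4 * exp (x * cosh u) := by linarith

lemma integrableOn_exp_neg_mul_cosh_mul_cosh {x : ℝ} (hx : 0 < x) :
    IntegrableOn (fun u => exp (-x * cosh u) * cosh u) (Ioi 0) := by
  refine Integrable.mono' ((integrableOn_exp_neg_Ioi 0).const_mul (4 / x ^ 2))
    (by fun_prop) (Eventually.of_forall fun u => ?_)
  rw [norm_of_nonneg (by positivity)]
  exact exp_neg_mul_cosh_mul_cosh_le hx u

lemma integrableOn_exp_neg_mul_cosh {x : ℝ} (hx : 0 < x) :
    IntegrableOn (fun u => exp (-x * cosh u)) (Ioi 0) := by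
  refine Integrable.mono' (integrableOn_exp_neg_mul_cosh_mul_cosh hx)
    (by fun_prop) (Eventually.of_forall fun u => ?_)
  rw [norm_of_nonneg (by positivity)]
  exact le_mul_of_one_le_right (exp_pos _).le (one_le_cosh u)

lemma integrableOn_exp_neg_mul_cosh_div {x : ℝ} (hx : 0 < x) :
    IntegrableOn (fun u => exp (-x * cosh u) / (1 + cosh u)) (Ioi 0) := by
  refine Integrable.mono' (integrableOn_exp_neg_mul_cosh hx)
    (Measurable.aestronglyMeasurable (by fun_prop)) (Eventually.of_forall fun u => ?_)
  have hc := one_le_cosh u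
  rw [norm_of_nonneg (by positivity)]
  exact div_le_self (exp_pos _).le (by linarith)

lemma hasDerivAt_sinh_div_one_add_cosh_mul_exp (x u : ℝ) :
    HasDerivAt (fun u => sinh u / (1 + cosh u) * exp (-x * cosh u))
      (exp (-x * cosh u) / (1 + cosh u)
        - x * (exp (-x * cosh u) * cosh u - exp (-x * cosh u))) u := by
  have hc : 1 + cosh u ≠ 0 := by linarith [cosh_pos u]
  have h := ((hasDerivAt_sinh u).fun_div ((hasDerivAt_cosh u).const_add 1) hc).fun_mul
    (((hasDerivAt_cosh u).const_mul (-x)).exp)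
  refine h.congr_deriv ?_
  have hs : sinh u ^ 2 = cosh u ^ 2 - 1 := sinh_sq u
  field_simp
  linear_combination (-1 - x * (1 + cosh u)) * hs

lemma tendsto_sinh_div_one_add_cosh_mul_exp {x : ℝ} (hx : 0 < x) :
    Tendsto (fun u => sinh u / (1 + cosh u) * exp (-x * cosh u)) atTop (𝓝 0) := by
  have hlim : Tendsto (fun u : ℝ => 4 / x ^ 2 * exp (-u)) atTop (𝓝 0) := by
    simpa using (tendsto_exp_neg_atTop_nhds_zero).const_mul (4 / x ^ 2)
  refine squeeze_zero' ?_ ?_ hlim <;> filter_upwards [eventually_ge_atTop 0] with u hu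
  · have hs : 0 ≤ sinh u := sinh_nonneg_iff.2 hu
    have hc := cosh_pos u
    positivity
  · have hc := one_le_cosh u
    have hf : sinh u / (1 + cosh u) ≤ cosh u :=
      div_le_of_le_mul₀ (by positivity) (by positivity) (by nlinarith [sinh_lt_cosh u])
    calc sinh u / (1 + cosh u) * exp (-x * cosh u) ≤ cosh u * exp (-x * cosh u) := by gcongr
      _ ≤ 4 / x ^ 2 * exp (-u) := by
        rw [mul_comm]; exact exp_neg_mul_cosh_mul_cosh_le hx u

lemma mul_K1_sub_K0_eq {x : ℝ} (hx : 0 < x) :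
    x * (K1 x - K0 x) = ∫ u in Ioi (0 : ℝ), exp (-x * cosh u) / (1 + cosh u) := by
  have h0 := integrableOn_exp_neg_mul_cosh hx
  have h1 := integrableOn_exp_neg_mul_cosh_mul_cosh hx
  have hd := integrableOn_exp_neg_mul_cosh_div hx
  have h := integral_Ioi_of_hasDerivAt_of_tendsto' (a := 0)
    (fun u _ => hasDerivAt_sinh_div_one_add_cosh_mul_exp x u)
    (hd.sub ((h1.sub h0).const_mul x)) (tendsto_sinh_div_one_add_cosh_mul_exp hx)
  rw [integral_sub hd (by exact (h1.sub h0).const_mul x), integral_const_mul, integral_sub h1 h0] at h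
  simp only [sinh_zero, zero_div, zero_mul, sub_zero] at h
  rw [K0, K1]
  linarith

lemma mul_K1_sub_K0_le {x : ℝ} (hx : 0 < x) : x * (K1 x - K0 x) ≤ K0 x := by
  rw [mul_K1_sub_K0_eq hx, K0]
  refine integral_mono (integrableOn_exp_neg_mul_cosh_div hx)
    (integrableOn_exp_neg_mul_cosh hx) fun u => ?_
  exact div_le_self (exp_pos _).le (by linarith [cosh_pos u])

lemma K0_pos {x : ℝ} (hx : 0 < x) : 0 < K0 x := by
  have : NeZero (volume.restrict (Ioi (0 : ℝ))) := ⟨by simp⟩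
  exact integral_exp_pos (integrableOn_exp_neg_mul_cosh hx)

theorem tangential_positivity (t : ℝ) (ht : 0 < t) :
    (4 + t^2) * K0 t - 2*t*K1 t > 0 := by
  have hpos := K0_pos ht
  have hle := mul_K1_sub_K0_le ht
  nlinarith [mul_nonneg (sq_nonneg (t - 1)) hpos.le]
end

section
/- For every ε > 0 and every real k ≠ 0, ∫_{−∞}^{∞} (x² + (3/2)ε²)/(x² + ε²)^{3/2} · cos(kx) dx = 2·K₀(ε|k|) + ε|k|·K₁(ε|k|). (This gives the normal-direction eigenvalue −(1/8π) times this quantity for the straight periodic slender body operator.) -/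
open Filter

open MeasureTheory Set

theorem rpow_three_halves {s : ℝ} (hs : 0 < s) : s ^ ((3 : ℝ) / 2) = s * √s := by
  rw [show (3 : ℝ) / 2 = 1 + 1 / 2 by norm_num, Real.rpow_add hs, Real.rpow_one,
    Real.sqrt_eq_rpow]

theorem integral_cos_mul_exp_neg_mul_sq {u : ℝ} (hu : 0 < u) (k : ℝ) :
    ∫ x : ℝ, Real.cos (k * x) * Real.exp (-u * x ^ 2)
      = √(Real.pi / u) * Real.exp (-k ^ 2 / (4 * u)) := by
  have hre (x : ℝ) : Real.cos (k * x) * Real.exp (-u * x ^ 2)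
      = RCLike.re (Complex.exp (Complex.I * k * x) * Complex.exp (-u * x ^ 2)) := by
    have : Complex.exp (-u * x ^ 2) = (Real.exp (-u * x ^ 2) : ℝ) := by push_cast; rfl
    rw [this, show Complex.I * k * x = ((k * x : ℝ) : ℂ) * Complex.I by push_cast; ring]
    rw [RCLike.re_eq_complex_re, Complex.re_mul_ofReal, Complex.exp_ofReal_mul_I_re]
  have hint : Integrable fun x : ℝ =>
      Complex.exp (Complex.I * k * x) * Complex.exp (-u * x ^ 2) := by
    refine (integrable_exp_neg_mul_sq hu).mono' (by fun_prop) (.of_forall fun x => le_of_eq ?_)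
    simp [Complex.norm_exp, ← Complex.ofReal_pow]
  simp_rw [hre]
  rw [integral_re hint, fourierIntegral_gaussian (by simpa using hu)]
  have h1 : ((Real.pi : ℂ) / u) ^ (1 / 2 : ℂ) = (√(Real.pi / u) : ℝ) := by
    rw [Real.sqrt_eq_rpow, Complex.ofReal_cpow (by positivity)]
    push_cast; rfl
  have h2 : Complex.exp (-(k : ℂ) ^ 2 / (4 * u)) = (Real.exp (-k ^ 2 / (4 * u)) : ℝ) := by
    push_cast; rfl
  rw [h1, h2, ← Complex.ofReal_mul]
  exact Complex.ofReal_re _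

theorem integrable_cos_mul_exp_neg_mul_sq {u : ℝ} (hu : 0 < u) (k : ℝ) :
    Integrable fun x : ℝ => Real.cos (k * x) * Real.exp (-u * x ^ 2) := by
  refine (integrable_exp_neg_mul_sq hu).mono' (by fun_prop) (.of_forall fun x => ?_)
  rw [norm_mul, Real.norm_eq_abs, Real.norm_eq_abs, Real.abs_exp]
  exact mul_le_of_le_one_left (Real.exp_nonneg _) (Real.abs_cos_le_one _)

theorem integrable_mul_sin_mul_exp_neg_mul_sq {u : ℝ} (hu : 0 < u) (k : ℝ) :
    Integrable fun x : ℝ => x * Real.sin (k * x) * Real.exp (-u * x ^ 2) := by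
  refine (integrable_mul_exp_neg_mul_sq hu).norm.mono' (by fun_prop) (.of_forall fun x => ?_)
  rw [mul_right_comm, norm_mul]
  exact mul_le_of_le_one_right (norm_nonneg _) (Real.abs_sin_le_one _)

theorem integral_mul_sin_mul_exp_neg_mul_sq {u : ℝ} (hu : 0 < u) (k : ℝ) :
    ∫ x : ℝ, x * Real.sin (k * x) * Real.exp (-u * x ^ 2)
      = k / (2 * u) * (√(Real.pi / u) * Real.exp (-k ^ 2 / (4 * u))) := by
  have hsin : Integrable fun x : ℝ => Real.sin (k * x) * Real.exp (-u * x ^ 2) := by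
    refine (integrable_exp_neg_mul_sq hu).mono' (by fun_prop) (.of_forall fun x => ?_)
    rw [norm_mul, Real.norm_eq_abs, Real.norm_eq_abs, Real.abs_exp]
    exact mul_le_of_le_one_left (Real.exp_nonneg _) (Real.abs_sin_le_one _)
  have hderiv (x : ℝ) : HasDerivAt (fun x => Real.sin (k * x) * Real.exp (-u * x ^ 2))
      (k * (Real.cos (k * x) * Real.exp (-u * x ^ 2))
        - 2 * u * (x * Real.sin (k * x) * Real.exp (-u * x ^ 2))) x := by
    have h1 := ((hasDerivAt_id x).const_mul k).sin
    have h2 := (((hasDerivAt_id x).pow 2).const_mul (-u)).exp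
    refine (h1.mul h2).congr_deriv ?_
    simp
    ring
  have hc := (integrable_cos_mul_exp_neg_mul_sq hu k).const_mul k
  have hs := (integrable_mul_sin_mul_exp_neg_mul_sq hu k).const_mul (2 * u)
  have h := integral_eq_zero_of_hasDerivAt_of_integrable hderiv (hc.sub hs) hsin
  rw [integral_sub hc hs, integral_const_mul, integral_const_mul,
    integral_cos_mul_exp_neg_mul_sq hu] at h
  rw [div_mul_eq_mul_div, eq_div_iff (by positivity)]
  linarith

theorem image_const_mul_exp {c : ℝ} (hc : 0 < c) :
    (fun t : ℝ => c * Real.exp t) '' univ = Ioi 0 := by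
  ext u
  simp only [image_univ, mem_range, mem_Ioi]
  refine ⟨fun ⟨t, ht⟩ => ht ▸ by positivity, fun hu => ⟨Real.log (u / c), ?_⟩⟩
  rw [Real.exp_log (by positivity)]
  field_simp

theorem injective_const_mul_exp {c : ℝ} (hc : 0 < c) :
    Function.Injective fun t : ℝ => c * Real.exp t :=
  (mul_right_injective₀ hc.ne').comp Real.exp_injective

theorem integral_Ioi_eq_integral_const_mul_exp (g : ℝ → ℝ) {c : ℝ} (hc : 0 < c) :
    ∫ u in Ioi 0, g u = ∫ t : ℝ, c * Real.exp t * g (c * Real.exp t) := by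
  rw [← image_const_mul_exp hc, integral_image_eq_integral_abs_deriv_smul MeasurableSet.univ
    (fun t _ => ((Real.hasDerivAt_exp t).const_mul c).hasDerivWithinAt)
    (injective_const_mul_exp hc).injOn, setIntegral_univ]
  simp [abs_of_pos hc]

theorem integrableOn_Ioi_iff_integrable_const_mul_exp (g : ℝ → ℝ) {c : ℝ} (hc : 0 < c) :
    IntegrableOn g (Ioi 0) ↔ Integrable fun t : ℝ => c * Real.exp t * g (c * Real.exp t) := by
  rw [← image_const_mul_exp hc, integrableOn_image_iff_integrableOn_abs_deriv_smul
    MeasurableSet.univ (fun t _ => ((Real.hasDerivAt_exp t).const_mul c).hasDerivWithinAt)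
    (injective_const_mul_exp hc).injOn, integrableOn_univ]
  simp [abs_of_pos hc]

theorem integral_Ioi_sqrt_mul_exp_neg_mul {s : ℝ} (hs : 0 < s) :
    ∫ u in Ioi 0, √u * Real.exp (-(s * u)) = √Real.pi / 2 * (s ^ ((3 : ℝ) / 2))⁻¹ := by
  have h := Real.integral_rpow_mul_exp_neg_mul_Ioi (a := 3 / 2) (by norm_num) hs
  have hΓ : Real.Gamma (3 / 2) = √Real.pi / 2 := by
    rw [show (3 : ℝ) / 2 = 1 / 2 + 1 by norm_num, Real.Gamma_add_one (by norm_num),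
      Real.Gamma_one_half_eq]
    ring
  rw [hΓ, one_div, Real.inv_rpow hs.le, mul_comm] at h
  rw [← h]
  refine setIntegral_congr_fun measurableSet_Ioi fun u _ => ?_
  simp only [Real.sqrt_eq_rpow]
  norm_num

theorem integrableOn_Ioi_sqrt_mul_exp_neg_mul {s : ℝ} (hs : 0 < s) :
    IntegrableOn (fun u => √u * Real.exp (-(s * u))) (Ioi 0) := by
  refine (integrableOn_rpow_mul_exp_neg_mul_rpow (s := 1 / 2) (p := 1) (by norm_num) one_pos
    hs).congr_fun (fun u _ => ?_) measurableSet_Ioi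
  simp [Real.sqrt_eq_rpow]

/-- Integrating the oscillatory kernel `cos (k x) / √(x² + ε²)` by parts replaces the integrand of
`normal_eigenvalue_integral` by this numerator over `(x² + ε²) ^ (3 / 2)`. -/
noncomputable def numerator (ε k x : ℝ) : ℝ :=
  1 / k * (x * Real.sin (k * x)) + ε ^ 2 / 2 * Real.cos (k * x)

theorem continuous_numerator (ε k : ℝ) : Continuous (numerator ε k) := by
  unfold numerator
  fun_prop

theorem integral_numerator_mul_exp_neg_mul_sq (ε : ℝ) {k u : ℝ} (hk : k ≠ 0) (hu : 0 < u) :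
    ∫ x : ℝ, numerator ε k x * Real.exp (-u * x ^ 2)
      = (1 / u + ε ^ 2) / 2 * (√(Real.pi / u) * Real.exp (-k ^ 2 / (4 * u))) := by
  simp only [numerator, add_mul, mul_assoc (1 / k), mul_assoc (ε ^ 2 / 2)]
  rw [integral_add ((integrable_mul_sin_mul_exp_neg_mul_sq hu k).const_mul _)
    ((integrable_cos_mul_exp_neg_mul_sq hu k).const_mul _), integral_const_mul,
    integral_const_mul, integral_mul_sin_mul_exp_neg_mul_sq hu,
    integral_cos_mul_exp_neg_mul_sq hu]
  field_simp

theorem integrable_numerator_div {ε : ℝ} (hε : 0 < ε) (k : ℝ) :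
    Integrable fun x : ℝ => numerator ε k x * ((x ^ 2 + ε ^ 2) ^ ((3 : ℝ) / 2))⁻¹ := by
  have hs (x : ℝ) : 0 < x ^ 2 + ε ^ 2 := by positivity
  have hbound : Integrable fun x : ℝ => (1 / |k| + ε / 2) * (x ^ 2 + ε ^ 2)⁻¹ := by
    refine Integrable.const_mul ?_ _
    convert! (integrable_inv_one_add_sq.comp_div hε.ne').const_mul (ε ^ 2)⁻¹ using 2 with x
    rw [← mul_inv]
    field_simp
    ring
  have hcont : Continuous fun x : ℝ => ((x ^ 2 + ε ^ 2) ^ ((3 : ℝ) / 2))⁻¹ :=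
    ((by fun_prop : Continuous fun x : ℝ => x ^ 2 + ε ^ 2).rpow_const
      fun x => .inl (hs x).ne').inv₀ fun x => (Real.rpow_pos_of_pos (hs x) _).ne'
  refine hbound.mono' ((continuous_numerator ε k).mul hcont).aestronglyMeasurable
    (.of_forall fun x => ?_)
  have hx : |x| ≤ √(x ^ 2 + ε ^ 2) := Real.abs_le_sqrt (by nlinarith [sq_nonneg ε])
  have hεs : ε ≤ √(x ^ 2 + ε ^ 2) := Real.le_sqrt_of_sq_le (by nlinarith [sq_nonneg x])
  have hnum : |numerator ε k x| ≤ (1 / |k| + ε / 2) * √(x ^ 2 + ε ^ 2) := by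
    unfold numerator
    refine (abs_add_le _ _).trans ?_
    simp only [abs_mul, abs_div, abs_one, abs_pow, abs_two, abs_of_pos hε]
    have h1 : |x| * |Real.sin (k * x)| ≤ √(x ^ 2 + ε ^ 2) :=
      (mul_le_of_le_one_right (abs_nonneg _) (Real.abs_sin_le_one _)).trans hx
    have h2 : ε ^ 2 / 2 * |Real.cos (k * x)| ≤ ε / 2 * √(x ^ 2 + ε ^ 2) :=
      (mul_le_of_le_one_right (by positivity) (Real.abs_cos_le_one _)).trans (by nlinarith)
    rw [add_mul]
    gcongr
  rw [Real.norm_eq_abs, abs_mul, abs_inv, abs_of_pos (Real.rpow_pos_of_pos (hs x) _),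
    rpow_three_halves (hs x), ← div_eq_mul_inv, div_le_iff₀ (by positivity [hs x])]
  refine hnum.trans_eq ?_
  have := (hs x).ne'
  field_simp

theorem integrable_prod_numerator {ε : ℝ} (hε : 0 < ε) (k : ℝ) :
    Integrable (Function.uncurry fun x u : ℝ =>
      numerator ε k x * (√u * Real.exp (-((x ^ 2 + ε ^ 2) * u))))
      (volume.prod (volume.restrict (Ioi 0))) := by
  have hs (x : ℝ) : 0 < x ^ 2 + ε ^ 2 := by positivity
  have hcont : Continuous (Function.uncurry fun x u : ℝ =>
      numerator ε k x * (√u * Real.exp (-((x ^ 2 + ε ^ 2) * u)))) :=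
    ((continuous_numerator ε k).comp continuous_fst).mul (by fun_prop)
  rw [integrable_prod_iff hcont.aestronglyMeasurable]
  refine ⟨.of_forall fun x =>
    Integrable.const_mul (integrableOn_Ioi_sqrt_mul_exp_neg_mul (hs x)) (numerator ε k x), ?_⟩
  convert! (integrable_numerator_div hε k).norm.const_mul (√Real.pi / 2) using 2 with x
  simp only [Function.uncurry_apply_pair, norm_mul, Real.norm_eq_abs, Real.abs_exp,
    abs_of_nonneg (Real.sqrt_nonneg _)]
  rw [integral_const_mul, integral_Ioi_sqrt_mul_exp_neg_mul (hs x), abs_inv,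
    abs_of_pos (Real.rpow_pos_of_pos (hs x) _)]
  ring

theorem integral_numerator_mul_sqrt_mul_exp (ε : ℝ) {k u : ℝ} (hk : k ≠ 0) (hu : 0 < u) :
    ∫ x : ℝ, numerator ε k x * (√u * Real.exp (-((x ^ 2 + ε ^ 2) * u)))
      = √Real.pi / 2 * ((1 / u + ε ^ 2) * Real.exp (-(ε ^ 2 * u + k ^ 2 / (4 * u)))) := by
  have h (x : ℝ) : numerator ε k x * (√u * Real.exp (-((x ^ 2 + ε ^ 2) * u)))
      = √u * Real.exp (-(ε ^ 2 * u)) * (numerator ε k x * Real.exp (-u * x ^ 2)) := by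
    rw [show -((x ^ 2 + ε ^ 2) * u) = -(ε ^ 2 * u) + -u * x ^ 2 by ring, Real.exp_add]
    ring
  simp_rw [h]
  rw [integral_const_mul, integral_numerator_mul_exp_neg_mul_sq ε hk hu,
    show -(ε ^ 2 * u + k ^ 2 / (4 * u)) = -(ε ^ 2 * u) + -k ^ 2 / (4 * u) by ring, Real.exp_add,
    Real.sqrt_div Real.pi_pos.le]
  have := (Real.sqrt_pos.2 hu).ne'
  field_simp

theorem integral_numerator_div {ε k : ℝ} (hε : 0 < ε) (hk : k ≠ 0) :
    ∫ x : ℝ, numerator ε k x * ((x ^ 2 + ε ^ 2) ^ ((3 : ℝ) / 2))⁻¹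
      = ∫ u in Ioi 0, (1 / u + ε ^ 2) * Real.exp (-(ε ^ 2 * u + k ^ 2 / (4 * u))) := by
  have hπ : √Real.pi / 2 ≠ 0 := by positivity
  refine mul_left_cancel₀ hπ ?_
  rw [← integral_const_mul, ← integral_const_mul]
  have h := integral_integral_swap (integrable_prod_numerator hε k)
  rw [setIntegral_congr_fun measurableSet_Ioi
    fun u hu => integral_numerator_mul_sqrt_mul_exp ε hk hu] at h
  rw [← h]
  refine integral_congr_ae (.of_forall fun x => ?_)
  simp only
  rw [integral_const_mul, integral_Ioi_sqrt_mul_exp_neg_mul (by positivity)]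
  ring

theorem integrableOn_Ioi_one_div_add_mul_exp {ε k : ℝ} (hε : 0 < ε) (hk : k ≠ 0) :
    IntegrableOn (fun u => (1 / u + ε ^ 2) * Real.exp (-(ε ^ 2 * u + k ^ 2 / (4 * u))))
      (Ioi 0) := by
  have h := (integrable_prod_numerator hε k).integral_prod_right
  have h' := IntegrableOn.congr_fun h
    (fun u hu => integral_numerator_mul_sqrt_mul_exp ε hk hu) measurableSet_Ioi
  exact (integrable_const_mul_iff (by simp; positivity) _).1 h'

theorem const_mul_exp_mul_kernel {ε k : ℝ} (hε : 0 < ε) (hk : k ≠ 0) (t : ℝ) :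
    |k| / (2 * ε) * Real.exp t * ((1 / (|k| / (2 * ε) * Real.exp t) + ε ^ 2) *
      Real.exp (-(ε ^ 2 * (|k| / (2 * ε) * Real.exp t)
        + k ^ 2 / (4 * (|k| / (2 * ε) * Real.exp t)))))
      = (1 + ε * |k| / 2 * Real.exp t) * Real.exp (-(ε * |k|) * Real.cosh t) := by
  have hk' := abs_pos.2 hk
  have he : -(ε ^ 2 * (|k| / (2 * ε) * Real.exp t) + k ^ 2 / (4 * (|k| / (2 * ε) * Real.exp t)))
      = -(ε * |k|) * Real.cosh t := by
    rw [Real.cosh_eq, Real.exp_neg, ← sq_abs k]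
    field_simp
    ring
  rw [he]
  field_simp

theorem integrable_one_add_mul_exp_neg_mul_cosh {ε k : ℝ} (hε : 0 < ε) (hk : k ≠ 0) :
    Integrable fun t : ℝ =>
      (1 + ε * |k| / 2 * Real.exp t) * Real.exp (-(ε * |k|) * Real.cosh t) := by
  have hk' := abs_pos.2 hk
  have h := (integrableOn_Ioi_iff_integrable_const_mul_exp _
    (show 0 < |k| / (2 * ε) by positivity)).1 (integrableOn_Ioi_one_div_add_mul_exp hε hk)
  simpa only [const_mul_exp_mul_kernel hε hk] using h

theorem integrable_exp_neg_mul_cosh {a : ℝ} (ha : 0 < a) :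
    Integrable fun t : ℝ => Real.exp (-a * Real.cosh t) := by
  have h := integrable_one_add_mul_exp_neg_mul_cosh one_pos ha.ne'
  rw [one_mul, abs_of_pos ha] at h
  refine h.mono' (by fun_prop) (.of_forall fun t => ?_)
  rw [Real.norm_eq_abs, Real.abs_exp]
  exact le_mul_of_one_le_left (Real.exp_nonneg _) (by simp; positivity)

theorem integrable_exp_mul_exp_neg_mul_cosh {a : ℝ} (ha : 0 < a) :
    Integrable fun t : ℝ => Real.exp t * Real.exp (-a * Real.cosh t) := by
  have h := integrable_one_add_mul_exp_neg_mul_cosh one_pos ha.ne'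
  rw [one_mul, abs_of_pos ha] at h
  convert! (h.sub (integrable_exp_neg_mul_cosh ha)).const_mul (2 / a) using 2 with t
  simp only [Pi.sub_apply]
  field_simp
  ring

theorem integrable_exp_neg_mul_cosh_mul_cosh {a : ℝ} (ha : 0 < a) :
    Integrable fun t : ℝ => Real.exp (-a * Real.cosh t) * Real.cosh t := by
  have h := integrable_exp_mul_exp_neg_mul_cosh ha
  convert! (h.add h.comp_neg).div_const 2 using 2 with t
  simp only [Pi.add_apply, Real.cosh_neg]
  rw [Real.cosh_eq t]
  ring

theorem integral_one_add_mul_exp_neg_mul_cosh {a : ℝ} (ha : 0 < a) :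
    ∫ t : ℝ, (1 + a / 2 * Real.exp t) * Real.exp (-a * Real.cosh t) = 2 * K0 a + a * K1 a := by
  have hg : Integrable fun t : ℝ => (1 + a / 2 * Real.exp t) * Real.exp (-a * Real.cosh t) := by
    simpa [abs_of_pos ha] using integrable_one_add_mul_exp_neg_mul_cosh one_pos ha.ne'
  rw [← intervalIntegral.integral_Iic_add_Ioi hg.integrableOn hg.integrableOn (b := 0),
    ← neg_zero, ← integral_comp_neg_Ioi, neg_zero,
    ← integral_add hg.comp_neg.integrableOn hg.integrableOn, K0, K1, ← integral_const_mul,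
    ← integral_const_mul, ← integral_add
      ((integrable_exp_neg_mul_cosh ha).integrableOn.const_mul _)
      ((integrable_exp_neg_mul_cosh_mul_cosh ha).integrableOn.const_mul _)]
  refine setIntegral_congr_fun measurableSet_Ioi fun t _ => ?_
  simp only [Real.cosh_neg]
  rw [← Real.cosh_add_sinh t, ← Real.cosh_sub_sinh t]
  ring

theorem integral_numerator_div_eq {ε k : ℝ} (hε : 0 < ε) (hk : k ≠ 0) :
    ∫ x : ℝ, numerator ε k x * ((x ^ 2 + ε ^ 2) ^ ((3 : ℝ) / 2))⁻¹
      = 2 * K0 (ε * |k|) + ε * |k| * K1 (ε * |k|) := by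
  have hk' := abs_pos.2 hk
  rw [integral_numerator_div hε hk,
    integral_Ioi_eq_integral_const_mul_exp _ (show 0 < |k| / (2 * ε) by positivity)]
  simp only [const_mul_exp_mul_kernel hε hk]
  exact integral_one_add_mul_exp_neg_mul_cosh (by positivity)

theorem hasDerivAt_sin_div_sqrt {ε k : ℝ} (hε : 0 < ε) (hk : k ≠ 0) (x : ℝ) :
    HasDerivAt (fun x => Real.sin (k * x) / (k * √(x ^ 2 + ε ^ 2)))
      ((x^2 + (3/2)*ε^2) / (x^2 + ε^2)^((3:ℝ)/2) * Real.cos (k*x)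
        - numerator ε k x * ((x ^ 2 + ε ^ 2) ^ ((3 : ℝ) / 2))⁻¹) x := by
  have hs : 0 < x ^ 2 + ε ^ 2 := by positivity
  have hr := Real.sqrt_pos.2 hs
  have h1 := ((hasDerivAt_id x).const_mul k).sin
  have h2 := ((((hasDerivAt_id x).pow 2).add_const (ε ^ 2)).sqrt hs.ne').const_mul k
  refine (h1.div h2 (by positivity)).congr_deriv ?_
  rw [rpow_three_halves hs, numerator]
  simp only [id, Pi.pow_apply]
  have hsq := Real.sq_sqrt hs.le
  generalize √(x ^ 2 + ε ^ 2) = r at *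
  rw [← hsq]
  have hε2 : ε ^ 2 = r ^ 2 - x ^ 2 := by linarith
  rw [hε2]
  field_simp
  ring

theorem tendsto_sin_div_sqrt (ε k : ℝ) :
    Tendsto (fun R : ℝ => Real.sin (k * R) / (k * √(R ^ 2 + ε ^ 2))) atTop (nhds 0) := by
  have hsq : Tendsto (fun R : ℝ => √(R ^ 2 + ε ^ 2)) atTop atTop :=
    Real.tendsto_sqrt_atTop.comp
      (tendsto_atTop_add_const_right _ _ (tendsto_pow_atTop two_ne_zero))
  have hlim : Tendsto (fun R : ℝ => |k|⁻¹ * (√(R ^ 2 + ε ^ 2))⁻¹) atTop (nhds 0) := by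
    simpa using hsq.inv_tendsto_atTop.const_mul |k|⁻¹
  refine squeeze_zero_norm (fun R => ?_) hlim
  rw [Real.norm_eq_abs, abs_div, abs_mul, abs_of_nonneg (Real.sqrt_nonneg _), div_eq_mul_inv,
    mul_inv]
  exact mul_le_of_le_one_left (by positivity) (Real.abs_sin_le_one _)

/-- Normal-direction eigenvalue integral for the straight periodic slender body operator,
as a principal value over the real line. -/
theorem normal_eigenvalue_integral (ε k : ℝ) (hε : 0 < ε) (hk : k ≠ 0) :
    Tendsto (fun R : ℝ => ∫ x in (-R)..R,
        (x^2 + (3/2)*ε^2) / (x^2 + ε^2)^((3:ℝ)/2) * Real.cos (k*x))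
      atTop (nhds (2 * K0 (ε * |k|) + ε*|k| * K1 (ε * |k|))) := by
  have hs (x : ℝ) : 0 < x ^ 2 + ε ^ 2 := by positivity
  have hpow : Continuous fun x : ℝ => (x ^ 2 + ε ^ 2) ^ ((3 : ℝ) / 2) :=
    (by fun_prop : Continuous fun x : ℝ => x ^ 2 + ε ^ 2).rpow_const fun x => .inl (hs x).ne'
  have hpow0 (x : ℝ) : (x ^ 2 + ε ^ 2) ^ ((3 : ℝ) / 2) ≠ 0 := (Real.rpow_pos_of_pos (hs x) _).ne'
  have hf : Continuous fun x : ℝ =>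
      (x ^ 2 + (3 / 2) * ε ^ 2) / (x ^ 2 + ε ^ 2) ^ ((3 : ℝ) / 2) * Real.cos (k * x) :=
    ((by fun_prop : Continuous fun x : ℝ => x ^ 2 + (3 / 2) * ε ^ 2).div hpow hpow0).mul
      (by fun_prop)
  have hg : Continuous fun x : ℝ =>
      numerator ε k x * ((x ^ 2 + ε ^ 2) ^ ((3 : ℝ) / 2))⁻¹ :=
    (continuous_numerator ε k).mul (hpow.inv₀ hpow0)
  have hparts (R : ℝ) := intervalIntegral.integral_eq_sub_of_hasDerivAt
    (fun x _ => hasDerivAt_sin_div_sqrt hε hk x) ((hf.sub hg).intervalIntegrable (-R) R)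
  have hB := tendsto_sin_div_sqrt ε k
  have hlim := (intervalIntegral_tendsto_integral (integrable_numerator_div hε k)
    tendsto_neg_atTop_atBot tendsto_id).add (hB.add hB)
  rw [integral_numerator_div_eq hε hk, add_zero, add_zero] at hlim
  refine hlim.congr fun R => ?_
  have h := hparts R
  rw [intervalIntegral.integral_sub (hf.intervalIntegrable _ _) (hg.intervalIntegrable _ _),
    mul_neg, Real.sin_neg, neg_sq, neg_div, sub_neg_eq_add] at h
  simp only [id]
  linarith
end

section
/- For every η > 1, every ε > 0, and every integer k with |k| ≥ 1, the eigenvalues of the regularized slender body operator for a straight periodic fiber are bounded away from zero: λᶻ_k := −(1/(8π))·(2 log η + 2K₀(ηπε|k|) + (2 + π²ε²k²)·K₀(πε|k|) − 2πε|k|·K₁(πε|k|)) ≤ −log(η)/(4π) and λˣ_k := −(1/(8π))·(2 log η + 2K₀(ηπε|k|) + πε|k|·K₁(πε|k|)) ≤ −log(η)/(4π). -/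
open MeasureTheory Filter Topology

lemma self_le_cosh {t : ℝ} (ht : 0 ≤ t) : t ≤ Real.cosh t :=
  (Real.self_le_sinh_iff.2 ht).trans (Real.sinh_lt_cosh t).le

lemma exp_neg_mul_cosh_le {x t : ℝ} (hx : 0 < x) (ht : 0 ≤ t) :
    Real.exp (-x * Real.cosh t) ≤ Real.exp (-x * t) :=
  Real.exp_le_exp.2 (by nlinarith [self_le_cosh ht])

lemma integrableOn_exp_neg_mul_cosh_s10 {x : ℝ} (hx : 0 < x) :
    IntegrableOn (fun t => Real.exp (-x * Real.cosh t)) (Set.Ioi 0) := by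
  refine Integrable.mono' (exp_neg_integrableOn_Ioi 0 hx)
    (by fun_prop : Continuous fun t => Real.exp (-x * Real.cosh t)).aestronglyMeasurable ?_
  refine (ae_restrict_mem measurableSet_Ioi).mono fun t ht => ?_
  rw [Real.norm_of_nonneg (Real.exp_pos _).le]
  exact exp_neg_mul_cosh_le hx (Set.mem_Ioi.1 ht).le

lemma integrableOn_exp_neg_mul_cosh_mul_cosh_s10 {x : ℝ} (hx : 0 < x) :
    IntegrableOn (fun t => Real.exp (-x * Real.cosh t) * Real.cosh t) (Set.Ioi 0) := by
  refine Integrable.mono' ((integrableOn_exp_neg_mul_cosh_s10 (half_pos hx)).const_mul (2 / x))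
    (by fun_prop : Continuous fun t =>
      Real.exp (-x * Real.cosh t) * Real.cosh t).aestronglyMeasurable ?_
  refine Eventually.of_forall fun t => ?_
  have hc := Real.cosh_pos t
  rw [Real.norm_of_nonneg (by positivity)]
  have hle : Real.cosh t ≤ 2 / x * Real.exp (x / 2 * Real.cosh t) := by
    have h := Real.add_one_le_exp (x / 2 * Real.cosh t)
    rw [div_mul_eq_mul_div, le_div_iff₀ hx]
    linarith
  calc Real.exp (-x * Real.cosh t) * Real.cosh t
      ≤ Real.exp (-x * Real.cosh t) * (2 / x * Real.exp (x / 2 * Real.cosh t)) := by gcongr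
    _ = 2 / x * Real.exp (-(x / 2) * Real.cosh t) := by
      rw [mul_left_comm, ← Real.exp_add]
      ring_nf

lemma K0_nonneg (x : ℝ) : 0 ≤ K0 x :=
  setIntegral_nonneg measurableSet_Ioi fun _ _ => (Real.exp_pos _).le

lemma K1_nonneg (x : ℝ) : 0 ≤ K1 x :=
  setIntegral_nonneg measurableSet_Ioi fun t _ =>
    mul_nonneg (Real.exp_pos _).le (Real.cosh_pos t).le

lemma hasDerivAt_exp_neg_mul_cosh_mul_sinh_div (x t : ℝ) :
    HasDerivAt (fun t => Real.exp (-x * Real.cosh t) * (Real.sinh t / (1 + Real.cosh t)))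
      (Real.exp (-x * Real.cosh t) * (1 / (1 + Real.cosh t))
        - x * (Real.exp (-x * Real.cosh t) * Real.cosh t - Real.exp (-x * Real.cosh t))) t := by
  have hc : 1 + Real.cosh t ≠ 0 := by linarith [Real.cosh_pos t]
  have h := (((Real.hasDerivAt_cosh t).const_mul (-x)).exp).mul
    ((Real.hasDerivAt_sinh t).div ((Real.hasDerivAt_cosh t).const_add 1) hc)
  refine h.congr_deriv ?_
  rw [Pi.div_apply]
  have hs := Real.cosh_sq t
  field_simp
  have hs' : Real.sinh t ^ 2 = Real.cosh t ^ 2 - 1 := by linarith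
  ring_nf
  simp only [hs']
  ring

lemma tendsto_exp_neg_mul_cosh_mul_sinh_div {x : ℝ} (hx : 0 < x) :
    Tendsto (fun t => Real.exp (-x * Real.cosh t) * (Real.sinh t / (1 + Real.cosh t)))
      atTop (𝓝 0) := by
  have hlim : Tendsto (fun t => Real.exp (-x * t)) atTop (𝓝 0) :=
    Real.tendsto_exp_atBot.comp (tendsto_id.const_mul_atTop_of_neg (neg_lt_zero.2 hx))
  refine squeeze_zero' ?_ ?_ hlim
  · filter_upwards [eventually_ge_atTop 0] with t ht
    have := Real.sinh_nonneg_iff.2 ht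
    have := Real.cosh_pos t
    positivity
  · filter_upwards [eventually_ge_atTop 0] with t ht
    have hc := Real.cosh_pos t
    have hle : Real.sinh t / (1 + Real.cosh t) ≤ 1 := by
      rw [div_le_one (by positivity)]
      linarith [Real.sinh_lt_cosh t]
    exact (mul_le_of_le_one_right (Real.exp_pos _).le hle).trans (exp_neg_mul_cosh_le hx ht)

/-- The bound `K₁(x) / K₀(x) ≤ 1 + 1 / (2x)`, with denominators cleared. -/
lemma two_mul_mul_K1_le {x : ℝ} (hx : 0 < x) : 2 * x * K1 x ≤ (2 * x + 1) * K0 x := by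
  have h0 := integrableOn_exp_neg_mul_cosh_s10 hx
  have h1 := integrableOn_exp_neg_mul_cosh_mul_cosh_s10 hx
  have hle (t : ℝ) : 1 / (1 + Real.cosh t) ≤ 1 / 2 :=
    one_div_le_one_div_of_le two_pos (by linarith [Real.one_le_cosh t])
  have hnn (t : ℝ) : 0 ≤ 1 / (1 + Real.cosh t) := by
    have := Real.cosh_pos t
    positivity
  have hcont : Continuous fun t => Real.exp (-x * Real.cosh t) * (1 / (1 + Real.cosh t)) :=
    (by fun_prop : Continuous fun t => Real.exp (-x * Real.cosh t)).mul
      (continuous_const.div (by fun_prop) fun t => by linarith [Real.cosh_pos t])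
  have h2 : IntegrableOn (fun t => Real.exp (-x * Real.cosh t) * (1 / (1 + Real.cosh t)))
      (Set.Ioi 0) := by
    refine Integrable.mono' h0 hcont.aestronglyMeasurable (Eventually.of_forall fun t => ?_)
    rw [Real.norm_of_nonneg (mul_nonneg (Real.exp_pos _).le (hnn t))]
    exact mul_le_of_le_one_right (Real.exp_pos _).le (by linarith [hle t])
  have hint := integral_Ioi_of_hasDerivAt_of_tendsto' (a := 0)
    (fun t _ => hasDerivAt_exp_neg_mul_cosh_mul_sinh_div x t)
    (h2.sub ((h1.sub h0).const_mul x)) (tendsto_exp_neg_mul_cosh_mul_sinh_div hx)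
  rw [integral_sub h2 (by exact (h1.sub h0).const_mul x), integral_const_mul, integral_sub h1 h0,
    Real.sinh_zero, zero_div, mul_zero, sub_zero] at hint
  have hbound : ∫ t in Set.Ioi (0 : ℝ), Real.exp (-x * Real.cosh t) * (1 / (1 + Real.cosh t))
      ≤ ∫ t in Set.Ioi (0 : ℝ), Real.exp (-x * Real.cosh t) * (1 / 2) :=
    integral_mono h2 (h0.mul_const _) fun t =>
      mul_le_mul_of_nonneg_left (hle t) (Real.exp_pos _).le
  rw [integral_mul_const] at hbound
  change _ - x * (K1 x - K0 x) = 0 at hint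
  change _ ≤ K0 x * (1 / 2) at hbound
  linarith

theorem regularized_eigenvalues_bounded_away (η ε : ℝ) (hη : 1 < η) (hε : 0 < ε)
    (k : ℤ) (hk : 1 ≤ |k|) :
    -(1/(8*Real.pi)) * (2*Real.log η + 2*K0 (η*Real.pi*ε*|(k:ℝ)|)
        + (2 + Real.pi^2*ε^2*(k:ℝ)^2) * K0 (Real.pi*ε*|(k:ℝ)|)
        - 2*Real.pi*ε*|(k:ℝ)| * K1 (Real.pi*ε*|(k:ℝ)|)) ≤ -Real.log η/(4*Real.pi) ∧
    -(1/(8*Real.pi)) * (2*Real.log η + 2*K0 (η*Real.pi*ε*|(k:ℝ)|)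
        + Real.pi*ε*|(k:ℝ)| * K1 (Real.pi*ε*|(k:ℝ)|)) ≤ -Real.log η/(4*Real.pi) := by
  have hk' : 0 < |(k : ℝ)| := by
    have : (1 : ℝ) ≤ |(k : ℝ)| := by exact_mod_cast hk
    linarith
  have hπ := Real.pi_pos
  have hx : 0 < Real.pi * ε * |(k : ℝ)| := by positivity
  have hsq : Real.pi ^ 2 * ε ^ 2 * (k : ℝ) ^ 2 = (Real.pi * ε * |(k : ℝ)|) ^ 2 := by
    rw [mul_pow, mul_pow, sq_abs]
  have hreg := K0_nonneg (η * Real.pi * ε * |(k : ℝ)|)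
  have hshift (S : ℝ) (hS : 0 ≤ S) :
      -(1 / (8 * Real.pi)) * (2 * Real.log η + S) ≤ -Real.log η / (4 * Real.pi) := by
    have heq : -(1 / (8 * Real.pi)) * (2 * Real.log η + S)
        = -Real.log η / (4 * Real.pi) - S / (8 * Real.pi) := by
      field_simp
      ring
    rw [heq]
    exact sub_le_self _ (by positivity)
  constructor
  · rw [hsq, add_sub_assoc, add_assoc, mul_assoc 2 Real.pi ε, mul_assoc 2 (Real.pi * ε)]
    apply hshift
    have h := two_mul_mul_K1_le hx
    have h' := mul_nonneg (sq_nonneg (Real.pi * ε * |(k : ℝ)| - 1))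
      (K0_nonneg (Real.pi * ε * |(k : ℝ)|))
    linarith
  · rw [add_assoc]
    apply hshift
    have h := mul_nonneg hx.le (K1_nonneg (Real.pi * ε * |(k : ℝ)|))
    linarith
end
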